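/- For γ ∈ (0,1) and λ > 0, let δ_{0,λ} be the bubble on ℝ² and let u : ℝ̄³₊ → ℝ be given by the Poisson-type convolution u(ζ̄, y) = ∫_{ℝ²} P_γ(ζ̄ - z, y) δ_{0,λ}(z) dz with kernel P_γ(x, y) = p_γ y^{2γ}/(|x|² + y²)^{1+γ}, where p_γ is a normalizing constant making ∫ P_γ(x,y)dx = 1 for each y > 0 (so u is the y^{1-2γ}-harmonic extension δ̄_{0,λ} of δ_{0,λ}); then sup over ζ = (ζ̄, ζ₃) ∈ ℝ̄³₊ of u(ζ)·(1+λ²|ζ|²)^{1-γ}/λ^{1-γ} is finite. -/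

import Mathlib

open MeasureTheory

/-- A negative power of the norm, of exponent greater than `-2`, is integrable on the unit disc. -/
lemma integrable_indicator_ball_norm_sq_inv_rpow {s : ℝ} (hs : s < 1) :
    Integrable ((Metric.ball (0 : EuclideanSpace ℝ (Fin 2)) 1).indicator
      fun v => ((‖v‖ ^ 2)⁻¹) ^ s) := by
  rw [integrable_indicator_iff measurableSet_ball]
  refine (integrableOn_fun_norm_addHaar (volume : Measure (EuclideanSpace ℝ (Fin 2)))
    (f := fun t : ℝ => ((t ^ 2)⁻¹) ^ s) (r := 1)).2 ?_
  have h : IntegrableOn (fun t : ℝ => t ^ (1 - 2 * s)) (Set.Ioo 0 1) :=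
    (intervalIntegral.integrableOn_Ioo_rpow_iff one_pos).2 (by linarith)
  refine h.congr_fun (fun t ht => ?_) measurableSet_Ioo
  have ht0 : 0 < t := ht.1
  have hsq : (t ^ 2)⁻¹ = t ^ (-2 : ℝ) := by
    rw [Real.rpow_neg ht0.le, Real.rpow_two]
  simp only [finrank_euclideanSpace, Fintype.card_fin, smul_eq_mul]
  rw [hsq, ← Real.rpow_mul ht0.le, Real.rpow_sub ht0, Real.rpow_one, neg_mul,
    Real.rpow_neg ht0.le]
  norm_num [div_eq_mul_inv]

/-- Here `d`, `t`, `a` stand for `‖z - w‖ ^ 2`, `‖w‖ ^ 2`, `‖z‖ ^ 2`. -/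
lemma kernel_mul_rpow_le {γ l y d t a : ℝ} (hγ0 : 0 < γ) (hγ1 : γ < 1) (hl : 0 < l)
    (hy : 0 < y) (hd : 0 ≤ d) (ht : 0 < t) (ha : 0 ≤ a) (hadt : a ≤ 2 * d + 2 * t) :
    y ^ (2 * γ) / (d + y ^ 2) ^ (1 + γ) *
        ((1 + l ^ 2 * (a + y ^ 2)) / (1 + l ^ 2 * t)) ^ (1 - γ) ≤
      8 * (y ^ (2 * γ) / (d + y ^ 2) ^ (1 + γ)) +
        32 / (a + y ^ 2) * (if t < a + y ^ 2 then ((a + y ^ 2) / t) ^ (1 - γ) else 0) := by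
  have hy2 : 0 < y ^ 2 := by positivity
  set r := a + y ^ 2 with hr
  have hr0 : 0 < r := by positivity
  have hQ : 0 ≤ y ^ (2 * γ) / (d + y ^ 2) ^ (1 + γ) := by positivity
  have hpow : ∀ b c : ℝ, 1 ≤ b → 0 ≤ c → c ≤ b → c ^ (1 - γ) ≤ b := fun b c hb hc hcb =>
    calc c ^ (1 - γ) ≤ b ^ (1 - γ) := Real.rpow_le_rpow hc hcb (by linarith)
      _ ≤ b ^ (1 : ℝ) := Real.rpow_le_rpow_of_exponent_le hb (by linarith)
      _ = b := Real.rpow_one b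
  rcases le_or_gt (1 + l ^ 2 * r) (8 * (1 + l ^ 2 * t)) with hcase | hcase
  · have h1 : ((1 + l ^ 2 * r) / (1 + l ^ 2 * t)) ^ (1 - γ) ≤ 8 :=
      hpow 8 _ (by norm_num) (by positivity) ((div_le_iff₀ (by positivity)).2 hcase)
    have h2 : 0 ≤ 32 / r * (if t < r then (r / t) ^ (1 - γ) else 0) := by
      split_ifs <;> positivity
    nlinarith [mul_le_mul_of_nonneg_left h1 hQ]
  · have hl2 : 0 < l ^ 2 := by positivity
    have htr : 8 * t < r := by
      by_contra! h
      nlinarith [mul_le_mul_of_nonneg_left h hl2.le]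
    have hlr : 1 ≤ l ^ 2 * r := by nlinarith [mul_pos hl2 ht]
    rw [if_pos (by linarith)]
    have hkernel : y ^ (2 * γ) / (d + y ^ 2) ^ (1 + γ) ≤ 16 / r := by
      have hnum : y ^ (2 * γ) ≤ r ^ γ := by
        rw [Real.rpow_mul hy.le, Real.rpow_two]
        exact Real.rpow_le_rpow hy2.le (by linarith) hγ0.le
      have hden : (r / 4) ^ (1 + γ) ≤ (d + y ^ 2) ^ (1 + γ) :=
        Real.rpow_le_rpow (by positivity) (by linarith) (by linarith)
      have h4 : (4 : ℝ) ^ (1 + γ) ≤ 16 := by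
        calc (4 : ℝ) ^ (1 + γ) ≤ 4 ^ (2 : ℝ) :=
              Real.rpow_le_rpow_of_exponent_le (by norm_num) (by linarith)
          _ = 16 := by norm_num
      calc y ^ (2 * γ) / (d + y ^ 2) ^ (1 + γ) ≤ r ^ γ / (r / 4) ^ (1 + γ) := by gcongr
        _ = 4 ^ (1 + γ) / r := by
          rw [Real.div_rpow hr0.le (by norm_num), Real.rpow_add hr0, Real.rpow_one]
          have : r ^ γ ≠ 0 := by positivity
          field_simp
        _ ≤ 16 / r := by gcongr
    have hratio : ((1 + l ^ 2 * r) / (1 + l ^ 2 * t)) ^ (1 - γ) ≤ 2 * (r / t) ^ (1 - γ) := by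
      calc ((1 + l ^ 2 * r) / (1 + l ^ 2 * t)) ^ (1 - γ) ≤ (2 * (r / t)) ^ (1 - γ) := by
            refine Real.rpow_le_rpow (by positivity) ?_ (by linarith)
            calc (1 + l ^ 2 * r) / (1 + l ^ 2 * t) ≤ (2 * (l ^ 2 * r)) / (l ^ 2 * t) := by
                  gcongr <;> linarith
              _ = 2 * (r / t) := by field_simp
        _ = 2 ^ (1 - γ) * (r / t) ^ (1 - γ) := Real.mul_rpow (by norm_num) (by positivity)
        _ ≤ 2 * (r / t) ^ (1 - γ) := by
            gcongr
            exact hpow 2 2 (by norm_num) (by norm_num) le_rfl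
    calc _ ≤ 16 / r * (2 * (r / t) ^ (1 - γ)) := by gcongr
      _ = 32 / r * (r / t) ^ (1 - γ) := by ring
      _ ≤ _ := by linarith

theorem stmt17 (γ l c₀ p : ℝ) (hγ : γ ∈ Set.Ioo (0 : ℝ) 1) (hl : 0 < l) (hc₀ : 0 < c₀)
    (hp : 0 < p)
    (hnorm : ∀ y : ℝ, 0 < y →
      (∫ x : EuclideanSpace ℝ (Fin 2), p * y ^ (2 * γ) / ((‖x‖ ^ 2 + y ^ 2) ^ (1 + γ))) = 1) :
    ∃ C : ℝ, ∀ (z : EuclideanSpace ℝ (Fin 2)) (y : ℝ), 0 ≤ y →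
      (∫ w : EuclideanSpace ℝ (Fin 2),
          p * y ^ (2 * γ) / ((‖z - w‖ ^ 2 + y ^ 2) ^ (1 + γ)) *
            (c₀ * (l / (1 + l ^ 2 * ‖w‖ ^ 2)) ^ (1 - γ)))
        * (1 + l ^ 2 * (‖z‖ ^ 2 + y ^ 2)) ^ (1 - γ) / l ^ (1 - γ) ≤ C := by
  obtain ⟨hγ0, hγ1⟩ := hγ
  set k : EuclideanSpace ℝ (Fin 2) → ℝ :=
    (Metric.ball (0 : EuclideanSpace ℝ (Fin 2)) 1).indicator
      fun v => ((‖v‖ ^ 2)⁻¹) ^ (1 - γ) with hk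
  have hkint : Integrable k := integrable_indicator_ball_norm_sq_inv_rpow (by linarith)
  have hk0 : ∀ v, 0 ≤ k v := fun v => Set.indicator_nonneg (fun v _ => by positivity) v
  have hJ : 0 ≤ ∫ v, k v := integral_nonneg hk0
  refine ⟨c₀ * (8 + 32 * p * ∫ v, k v), fun z y hy => ?_⟩
  rcases hy.eq_or_lt with rfl | hy
  · rw [Real.zero_rpow (by positivity)]
    simp only [mul_zero, zero_div, zero_mul, integral_zero]
    positivity
  set r := ‖z‖ ^ 2 + y ^ 2 with hr
  have hr0 : 0 < r := by positivity
  set R := √r with hR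
  have hR0 : 0 < R := Real.sqrt_pos.2 hr0
  have hRr : R ^ 2 = r := Real.sq_sqrt hr0.le
  set Q : EuclideanSpace ℝ (Fin 2) → ℝ := fun w =>
    p * y ^ (2 * γ) / ((‖z - w‖ ^ 2 + y ^ 2) ^ (1 + γ)) with hQ
  have hQ1 : ∫ w, Q w = 1 := by
    rw [← hnorm y hy]
    exact integral_sub_left_eq_self
      (fun x => p * y ^ (2 * γ) / ((‖x‖ ^ 2 + y ^ 2) ^ (1 + γ))) volume z
  have hQint : Integrable Q := integrable_of_integral_eq_one hQ1
  have hkR : Integrable fun w => k (R⁻¹ • w) := hkint.comp_smul (inv_ne_zero hR0.ne')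
  have hkR1 : ∫ w, k (R⁻¹ • w) = r * ∫ v, k v := by
    rw [Measure.integral_comp_inv_smul_of_nonneg _ _ hR0.le]
    simp [hRr]
  have hkRw : ∀ w, k (R⁻¹ • w) = if ‖w‖ ^ 2 < r then (r / ‖w‖ ^ 2) ^ (1 - γ) else 0 := by
    intro w
    have hmem : R⁻¹ • w ∈ Metric.ball (0 : EuclideanSpace ℝ (Fin 2)) 1 ↔ ‖w‖ ^ 2 < r := by
      rw [mem_ball_zero_iff, norm_smul, norm_inv, Real.norm_of_nonneg hR0.le,
        inv_mul_lt_one₀ hR0, ← hRr, pow_lt_pow_iff_left₀ (norm_nonneg w) hR0.le two_ne_zero]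
    split_ifs with h
    · rw [hk, Set.indicator_of_mem (hmem.2 h), norm_smul, norm_inv, Real.norm_of_nonneg hR0.le,
        mul_pow, inv_pow, hRr, mul_inv, inv_inv, div_eq_mul_inv]
    · exact Set.indicator_of_notMem (fun h' => h (hmem.1 h')) _
  rw [mul_div_assoc, ← integral_mul_const]
  have hbound : Integrable fun w => c₀ * (8 * Q w + 32 * p / r * k (R⁻¹ • w)) :=
    ((hQint.const_mul 8).add (hkR.const_mul _)).const_mul _
  refine (integral_mono_of_nonneg (Filter.Eventually.of_forall fun w => ?_) hbound ?_).trans_eq ?_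
  · simp only [Pi.zero_apply]
    positivity
  · have hne : ∀ᵐ w : EuclideanSpace ℝ (Fin 2), w ≠ 0 := by
      simp [ae_iff]
    filter_upwards [hne] with w hw
    have hadt : ‖z‖ ^ 2 ≤ 2 * ‖z - w‖ ^ 2 + 2 * ‖w‖ ^ 2 := by
      have h := norm_add_le (z - w) w
      rw [sub_add_cancel] at h
      nlinarith [sq_nonneg (‖z - w‖ - ‖w‖), norm_nonneg z, norm_nonneg w, norm_nonneg (z - w)]
    have hmain := kernel_mul_rpow_le hγ0 hγ1 hl hy (sq_nonneg ‖z - w‖)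
      (pow_pos (norm_pos_iff.2 hw) 2) (sq_nonneg ‖z‖) hadt
    rw [← hr, ← hkRw] at hmain
    have hl0 : l ^ (1 - γ) ≠ 0 := by positivity
    calc Q w * (c₀ * (l / (1 + l ^ 2 * ‖w‖ ^ 2)) ^ (1 - γ)) *
          ((1 + l ^ 2 * r) ^ (1 - γ) / l ^ (1 - γ))
        = c₀ * p * (y ^ (2 * γ) / (‖z - w‖ ^ 2 + y ^ 2) ^ (1 + γ) *
            ((1 + l ^ 2 * r) / (1 + l ^ 2 * ‖w‖ ^ 2)) ^ (1 - γ)) := by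
          rw [Real.div_rpow hl.le (by positivity), Real.div_rpow (by positivity) (by positivity)]
          simp only [hQ]
          field_simp
      _ ≤ c₀ * p * (8 * (y ^ (2 * γ) / (‖z - w‖ ^ 2 + y ^ 2) ^ (1 + γ)) +
            32 / r * k (R⁻¹ • w)) := by gcongr
      _ = c₀ * (8 * Q w + 32 * p / r * k (R⁻¹ • w)) := by
          simp only [hQ]
          ring
  · rw [integral_const_mul, integral_add (hQint.const_mul 8) (hkR.const_mul _),
      integral_const_mul, integral_const_mul, hQ1, hkR1]
    field_simp
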